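/- Let f_i(λ) = C_i·|λ|^{−2α_i}(1 + λ²)^{−β_i} for λ ∈ ℝ\{0}, i = 1,2, with constants C_i > 0, 0 < α_i < 1/2 and β_i > 1/2, and set α := α₁ + α₂. If α < 1/2, then as T → ∞, S₁(T) := (1/T) ∫₀ᵀ∫₀ᵀ f̂₁(t−s) f̂₂(s−t) dt ds = 2π ∫_ℝ f₁(λ)f₂(λ) dλ − C(α₁,α₂)·T^{−(1−2α)} + o(T^{−(1−2α)}), where C(α₁,α₂) = [2 C₁C₂ π² / (cos(πα₁) cos(πα₂) Γ(2α₁) Γ(2α₂))] · [1 / (2α(1 − 2α))] and Γ is the Gamma function. -/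

import Mathlib

open MeasureTheory Filter Set Asymptotics Real
open scoped ENNReal Topology

noncomputable section

/-- Fourier transform of an integrable function on ℝ. -/
def hatR (h : ℝ → ℝ) (t : ℝ) : ℂ :=
  ∫ x : ℝ, Complex.exp (Complex.I * x * t) * (h x)

/-- S₁(T) = (1/T)·tr[W_T(f₁)W_T(f₂)]. -/
def S1W (f₁ f₂ : ℝ → ℝ) (T : ℝ) : ℂ :=
  (T : ℂ)⁻¹ * ∫ t in (0 : ℝ)..T, ∫ s in (0 : ℝ)..T, hatR f₁ (t - s) * hatR f₂ (s - t)

/-- The constant C(α₁,α₂) in the second-order expansion. -/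
def Cα (C₁ C₂ α₁ α₂ : ℝ) : ℝ :=
  2 * C₁ * C₂ * π ^ 2 /
    (Real.cos (π * α₁) * Real.cos (π * α₂) * Real.Gamma (2 * α₁) * Real.Gamma (2 * α₂)) *
  (1 / (2 * (α₁ + α₂) * (1 - 2 * (α₁ + α₂))))


/-- Fourier transform of the Gaussian `exp (-y x^2)`, at `t`. -/
def gphi (y t : ℝ) : ℝ := √(π / y) * Real.exp (-t ^ 2 / (4 * y))

/-- Fourier transform of a mixture of Gaussians. -/
def gh (M : Measure ℝ) (t : ℝ) : ℝ := ∫ y, gphi y t ∂M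

/-- `f` is a Gaussian mixture with mixing measure `M`. -/
structure IsMix (M : Measure ℝ) (f : ℝ → ℝ) : Prop where
  pos : ∀ᵐ y ∂M, 0 < y
  int : ∀ᵐ x : ℝ, Integrable (fun y => Real.exp (-y * x ^ 2)) M
  eq : ∀ᵐ x : ℝ, f x = ∫ y, Real.exp (-y * x ^ 2) ∂M
  fint : Integrable f

lemma gphi_meas : Measurable (fun p : ℝ × ℝ => gphi p.1 p.2) := by
  unfold gphi; fun_prop

lemma gphi_nonneg (y t : ℝ) : 0 ≤ gphi y t := by unfold gphi; positivity

lemma gphi_le (y t : ℝ) (hy : 0 < y) : gphi y t ≤ √(π / y) := by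
  unfold gphi
  apply mul_le_of_le_one_right (by positivity)
  rw [Real.exp_le_one_iff]
  apply div_nonpos_of_nonpos_of_nonneg <;> nlinarith [sq_nonneg t]

lemma IsMix.prod_int {M : Measure ℝ} [SFinite M] {f : ℝ → ℝ} (h : IsMix M f) :
    Integrable (fun p : ℝ × ℝ => Real.exp (-p.2 * p.1 ^ 2)) (volume.prod M) := by
  rw [integrable_prod_iff]
  · refine ⟨h.int, ?_⟩
    refine h.fint.congr ?_
    filter_upwards [h.eq] with x hx
    simp [hx]
  · apply Measurable.aestronglyMeasurable
    fun_prop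

lemma IsMix.sqrt_int {M : Measure ℝ} [SFinite M] {f : ℝ → ℝ} (h : IsMix M f) :
    Integrable (fun y => √(π / y)) M := by
  have h1 := h.prod_int.integral_prod_right
  simpa only [integral_gaussian] using h1

lemma IsMix.phi_int {M : Measure ℝ} [SFinite M] {f : ℝ → ℝ} (h : IsMix M f) (t : ℝ) :
    Integrable (fun y => gphi y t) M := by
  refine h.sqrt_int.mono' ?_ ?_
  · exact (gphi_meas.comp (measurable_id.prodMk measurable_const)).aestronglyMeasurable
  · filter_upwards [h.pos] with y hy
    rw [Real.norm_of_nonneg (gphi_nonneg _ _)]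
    exact gphi_le y t hy

lemma gauss_ft (y t : ℝ) (hy : 0 < y) :
    ∫ x : ℝ, Complex.exp (Complex.I * x * t) * (Real.exp (-y * x ^ 2) : ℝ) = (gphi y t : ℂ) := by
  have := @fourierIntegral_gaussian (y : ℂ) (by simpa using hy) t
  rw [gphi, Real.sqrt_eq_rpow]
  push_cast
  rw [Complex.ofReal_cpow (by positivity)]
  push_cast
  rw [← this]
  congr 1; ext x
  congr 2; ring

lemma IsMix.hat {M : Measure ℝ} [SFinite M] {f : ℝ → ℝ} (h : IsMix M f) (t : ℝ) :
    hatR f t = (gh M t : ℂ) := by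
  have h1 : hatR f t = ∫ x : ℝ, ∫ y, Complex.exp (Complex.I * x * t) *
      (Real.exp (-y * x ^ 2) : ℝ) ∂M := by
    unfold hatR
    apply integral_congr_ae
    filter_upwards [h.eq] with x hx
    rw [hx, integral_const_mul, integral_complex_ofReal]
  rw [h1, integral_integral_swap]
  · rw [gh, ← integral_complex_ofReal]
    apply integral_congr_ae
    filter_upwards [h.pos] with y hy
    exact gauss_ft y t hy
  · have h2 := h.prod_int.ofReal (𝕜 := ℂ)
    refine h2.mono ?_ ?_
    · apply Measurable.aestronglyMeasurable
      simp only [Function.uncurry_def]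
      fun_prop
    · refine Eventually.of_forall fun p => ?_
      simp only [Function.uncurry_def, norm_mul]
      have : ‖Complex.exp (Complex.I * p.1 * t)‖ = 1 := by
        rw [Complex.norm_exp]; simp
      rw [this, one_mul]
      rfl

lemma gh_even (M : Measure ℝ) (t : ℝ) : gh M (-t) = gh M t := by simp [gh, gphi]

lemma gh_nonneg (M : Measure ℝ) (t : ℝ) : 0 ≤ gh M t := integral_nonneg fun y => gphi_nonneg y t

lemma IsMix.cont {M : Measure ℝ} [SFinite M] {f : ℝ → ℝ} (h : IsMix M f) :
    Continuous (gh M) := by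
  refine continuous_of_dominated (F := fun t y => gphi y t) (bound := fun y => √(π / y))
    (fun t => (h.phi_int t).aestronglyMeasurable) ?_ h.sqrt_int ?_
  · intro t
    filter_upwards [h.pos] with y hy
    rw [Real.norm_of_nonneg (gphi_nonneg _ _)]
    exact gphi_le y t hy
  · refine Eventually.of_forall fun y => ?_
    unfold gphi
    fun_prop

lemma gauss_pars (y z : ℝ) (hy : 0 < y) (hz : 0 < z) :
    ∫⁻ t : ℝ, ENNReal.ofReal (gphi y t) * ENNReal.ofReal (gphi z t) =
      ENNReal.ofReal (2 * π) *
        ∫⁻ x : ℝ, ENNReal.ofReal (Real.exp (-y * x ^ 2)) * ENNReal.ofReal (Real.exp (-z * x ^ 2)) := by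
  have e1 : ∀ t : ℝ, ENNReal.ofReal (gphi y t) * ENNReal.ofReal (gphi z t) =
      ENNReal.ofReal (√(π / y) * √(π / z)) *
        ENNReal.ofReal (Real.exp (-((y + z) / (4 * y * z)) * t ^ 2)) := by
    intro t
    rw [← ENNReal.ofReal_mul (gphi_nonneg _ _), ← ENNReal.ofReal_mul (by positivity)]
    congr 1
    unfold gphi
    have : Real.exp (-((y + z) / (4 * y * z)) * t ^ 2) =
      Real.exp (-t ^ 2 / (4 * y)) * Real.exp (-t ^ 2 / (4 * z)) := by
      rw [← Real.exp_add]; congr 1; field_simp; ring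
    rw [this]; ring
  have e2 : ∀ x : ℝ, ENNReal.ofReal (Real.exp (-y * x ^ 2)) * ENNReal.ofReal (Real.exp (-z * x ^ 2))
      = ENNReal.ofReal (Real.exp (-(y + z) * x ^ 2)) := by
    intro x
    rw [← ENNReal.ofReal_mul (by positivity), ← Real.exp_add]
    congr 2; ring
  simp_rw [e1, e2]
  have hb : 0 < (y + z) / (4 * y * z) := by positivity
  rw [lintegral_const_mul _ (by fun_prop),
    ← ofReal_integral_eq_lintegral_ofReal (integrable_exp_neg_mul_sq hb)
      (Eventually.of_forall fun x => by positivity),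
    ← ofReal_integral_eq_lintegral_ofReal (integrable_exp_neg_mul_sq (by positivity : 0 < y + z))
      (Eventually.of_forall fun x => by positivity),
    integral_gaussian, integral_gaussian, ← ENNReal.ofReal_mul (by positivity),
    ← ENNReal.ofReal_mul (by positivity)]
  congr 1
  have hpi := Real.pi_pos
  rw [← Real.sqrt_mul (by positivity), ← Real.sqrt_mul (by positivity)]
  have : (2 * π) = √((2 * π) ^ 2) := by rw [Real.sqrt_sq (by positivity)]
  rw [this, ← Real.sqrt_mul (by positivity)]
  congr 1
  field_simp
  norm_num

lemma IsMix.nonneg {M : Measure ℝ} {f : ℝ → ℝ} (h : IsMix M f) : ∀ᵐ x : ℝ, 0 ≤ f x := by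
  filter_upwards [h.eq] with x hx
  rw [hx]; exact integral_nonneg fun y => by positivity

lemma parseval {M N : Measure ℝ} [SFinite M] [SFinite N] {f g : ℝ → ℝ}
    (hf : IsMix M f) (hg : IsMix N g) :
    ∫ t, gh M t * gh N t = 2 * π * ∫ x, f x * g x := by
  have key : ∫⁻ t, ENNReal.ofReal (gh M t * gh N t) =
      ENNReal.ofReal (2 * π) * ∫⁻ x, ENNReal.ofReal (f x * g x) := by
    have a1 : ∀ t, ENNReal.ofReal (gh M t * gh N t) =
        ∫⁻ p, ENNReal.ofReal (gphi p.1 t) * ENNReal.ofReal (gphi p.2 t) ∂(M.prod N) := by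
      intro t
      rw [lintegral_prod_mul (f := fun y => ENNReal.ofReal (gphi y t))
        (g := fun y => ENNReal.ofReal (gphi y t)), ENNReal.ofReal_mul (gh_nonneg _ _), gh, gh,
        ofReal_integral_eq_lintegral_ofReal (hf.phi_int t)
          (Eventually.of_forall fun y => gphi_nonneg y t),
        ofReal_integral_eq_lintegral_ofReal (hg.phi_int t)
          (Eventually.of_forall fun y => gphi_nonneg y t)]
      · exact (hf.phi_int t).aemeasurable.ennreal_ofReal
      · exact (hg.phi_int t).aemeasurable.ennreal_ofReal
    have a2 : ∫⁻ x, ENNReal.ofReal (f x * g x) =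
        ∫⁻ x : ℝ, ∫⁻ p, ENNReal.ofReal (Real.exp (-p.1 * x ^ 2)) *
          ENNReal.ofReal (Real.exp (-p.2 * x ^ 2)) ∂(M.prod N) := by
      apply lintegral_congr_ae
      filter_upwards [hf.eq, hg.eq, hf.int, hg.int, hf.nonneg] with x h1 h2 h3 h4 h5
      rw [lintegral_prod_mul (f := fun y => ENNReal.ofReal (Real.exp (-y * x ^ 2)))
        (g := fun y => ENNReal.ofReal (Real.exp (-y * x ^ 2))), ENNReal.ofReal_mul h5, h1, h2,
        ofReal_integral_eq_lintegral_ofReal h3 (Eventually.of_forall fun y => by positivity),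
        ofReal_integral_eq_lintegral_ofReal h4 (Eventually.of_forall fun y => by positivity)]
      · fun_prop
      · fun_prop
    simp_rw [a1]
    have s2 := lintegral_lintegral_swap (μ := (volume : Measure ℝ)) (ν := M.prod N)
      (f := fun x p => ENNReal.ofReal (Real.exp (-p.1 * x ^ 2)) *
          ENNReal.ofReal (Real.exp (-p.2 * x ^ 2)))
      (by simp only [Function.uncurry_def]
          apply Measurable.aemeasurable
          fun_prop)
    rw [a2, s2, lintegral_lintegral_swap, ← lintegral_const_mul']
    · apply lintegral_congr_ae
      have b1 : ∀ᵐ p ∂(M.prod N), 0 < p.1 := Measure.quasiMeasurePreserving_fst.ae hf.pos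
      have b2 : ∀ᵐ p ∂(M.prod N), 0 < p.2 := Measure.quasiMeasurePreserving_snd.ae hg.pos
      filter_upwards [b1, b2] with p h1 h2
      exact gauss_pars _ _ h1 h2
    · exact ENNReal.ofReal_ne_top
    · simp only [Function.uncurry_def, gphi]
      apply Measurable.aemeasurable
      fun_prop
  rw [integral_eq_lintegral_of_nonneg_ae, integral_eq_lintegral_of_nonneg_ae, key,
    ENNReal.toReal_mul, ENNReal.toReal_ofReal (by positivity)]
  · filter_upwards [hf.nonneg, hg.nonneg] with x h1 h2 using mul_nonneg h1 h2
  · exact hf.fint.aestronglyMeasurable.mul hg.fint.aestronglyMeasurable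
  · exact Eventually.of_forall fun t => mul_nonneg (gh_nonneg _ _) (gh_nonneg _ _)
  · exact (hf.cont.mul hg.cont).aestronglyMeasurable

/-- The measure `u^(a-1) exp(-r u) du` on the positive half-line. -/
def Pm (a r : ℝ) : Measure ℝ :=
  (volume.restrict (Ioi 0)).withDensity
    (fun u => ENNReal.ofReal (u ^ (a - 1) * Real.exp (-(r * u))))

instance (a r : ℝ) : SFinite (Pm a r) := by unfold Pm; infer_instance

/-- Mixing measure. -/
def Mx (c a b : ℝ) : Measure ℝ :=
  ENNReal.ofReal c • ((Pm b 1).prod (Pm a 0)).map (fun p => p.1 + p.2)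

instance (c a b : ℝ) : SFinite (Mx c a b) := by unfold Mx; infer_instance

lemma Pm_dens_meas (a r : ℝ) :
    Measurable (fun u : ℝ => ENNReal.ofReal (u ^ (a - 1) * Real.exp (-(r * u)))) := by fun_prop

lemma Pm_pos (a r : ℝ) : ∀ᵐ u ∂(Pm a r), 0 < u := by
  have : ∀ᵐ u ∂((volume : Measure ℝ).restrict (Ioi 0)), 0 < u :=
    ae_restrict_mem measurableSet_Ioi
  exact (withDensity_absolutelyContinuous _ _) this

lemma Pm_integral (a r : ℝ) (φ : ℝ → ℝ) :
    ∫ u, φ u ∂(Pm a r) = ∫ u in Ioi (0 : ℝ), (u ^ (a - 1) * Real.exp (-(r * u))) * φ u := by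
  unfold Pm
  rw [integral_withDensity_eq_integral_toReal_smul (Pm_dens_meas a r) (by simp)]
  apply setIntegral_congr_fun measurableSet_Ioi
  intro u hu
  have hu : 0 < u := hu
  simp only [smul_eq_mul]
  rw [ENNReal.toReal_ofReal (by positivity)]

lemma Pm_integrable (a r : ℝ) (φ : ℝ → ℝ) :
    Integrable φ (Pm a r) ↔
      IntegrableOn (fun u => (u ^ (a - 1) * Real.exp (-(r * u))) * φ u) (Ioi 0) := by
  unfold Pm
  rw [integrable_withDensity_iff_integrable_smul' (Pm_dens_meas a r) (by simp)]
  apply integrableOn_congr_fun _ measurableSet_Ioi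
  intro u hu
  have hu : 0 < u := hu
  simp only [smul_eq_mul]
  rw [ENNReal.toReal_ofReal (by positivity)]

lemma Pm_exp_int (a r s : ℝ) (ha : 0 < a) (hrs : 0 < r + s) :
    Integrable (fun u => Real.exp (-(s * u))) (Pm a r) := by
  rw [Pm_integrable]
  have := @integrableOn_rpow_mul_exp_neg_mul_rpow 1 (a - 1) (r + s) (by linarith) one_pos hrs
  refine this.congr_fun ?_ measurableSet_Ioi
  intro u hu
  simp only [Real.rpow_one]
  rw [mul_assoc, ← Real.exp_add]
  congr 2; ring

lemma Pm_exp (a r s : ℝ) (ha : 0 < a) (hrs : 0 < r + s) :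
    ∫ u, Real.exp (-(s * u)) ∂(Pm a r) = Real.Gamma a * (r + s) ^ (-a) := by
  rw [Pm_integral]
  have := @Real.integral_rpow_mul_exp_neg_mul_Ioi a (r + s) ha hrs
  rw [one_div, Real.inv_rpow hrs.le, ← Real.rpow_neg hrs.le, mul_comm] at this
  rw [← this]
  apply setIntegral_congr_fun measurableSet_Ioi
  intro u hu
  simp only
  rw [mul_assoc, ← Real.exp_add]
  congr 2; ring

lemma f_integrable (c a b : ℝ) (ha1 : a < 1 / 2) (ha : 0 < a) (hb : 1 / 2 < b) :
    Integrable (fun x : ℝ => c * |x| ^ (-(2 * a)) * (1 + x ^ 2) ^ (-b)) := by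
  simp_rw [mul_assoc]
  apply Integrable.const_mul
  have h1 : Integrable (fun x : ℝ => (1 + x ^ 2) ^ (-b)) := by
    have := @integrable_rpow_neg_one_add_norm_sq ℝ _ _ _ _ _ volume _ (2 * b) (by simp; linarith)
    refine this.congr (Eventually.of_forall fun x => ?_)
    simp only [Real.norm_eq_abs, sq_abs]
    congr 1; ring
  have h2 : IntegrableOn (fun x : ℝ => |x| ^ (-(2 * a))) (Icc (-1) 1) := by
    have h3 : IntegrableOn (fun x : ℝ => |x| ^ (-(2 * a))) (Ioc 0 1) := by
      have := (intervalIntegral.intervalIntegrable_rpow' (a := 0) (b := 1)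
        (r := -(2 * a)) (by linarith)).1
      refine this.congr_fun ?_ measurableSet_Ioc
      intro x hx
      simp only
      rw [abs_of_pos hx.1]
    have h4 : IntegrableOn (fun x : ℝ => |x| ^ (-(2 * a))) (Ico (-1) 0) := by
      have := h3.comp_neg
      simpa using this
    have h5 : Icc (-1 : ℝ) 1 = (Ico (-1) 0 ∪ Ioc 0 1) ∪ {0} := by
      ext x; simp only [mem_Icc, mem_union, mem_Ico, mem_Ioc, mem_singleton_iff]
      constructor
      · rintro ⟨h, h'⟩
        rcases lt_trichotomy x 0 with h0 | h0 | h0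
        · exact Or.inl (Or.inl ⟨h, h0⟩)
        · exact Or.inr h0
        · exact Or.inl (Or.inr ⟨h0, h'⟩)
      · rintro ((⟨h, h'⟩ | ⟨h, h'⟩) | h) <;> constructor <;> linarith
    rw [h5]
    refine (h4.union h3).union ?_
    exact integrableOn_singleton (hx := by simp)
  rw [← integrable_indicator_iff measurableSet_Icc] at h2
  refine (h1.add h2).mono' ?_ (Eventually.of_forall fun x => ?_)
  · apply Measurable.aestronglyMeasurable
    fun_prop
  · rw [Real.norm_of_nonneg (by positivity)]
    simp only [Pi.add_apply]
    have p1 : (0 : ℝ) ≤ |x| ^ (-(2 * a)) := by positivity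
    have p2 : (0 : ℝ) ≤ (1 + x ^ 2) ^ (-b) := by positivity
    by_cases hx : x ∈ Icc (-1 : ℝ) 1
    · rw [indicator_of_mem hx]
      have : (1 + x ^ 2) ^ (-b) ≤ 1 :=
        Real.rpow_le_one_of_one_le_of_nonpos (by nlinarith [sq_nonneg x]) (by linarith)
      nlinarith
    · rw [indicator_of_notMem hx]
      have h1x : 1 ≤ |x| := by
        by_contra hh
        exact hx (abs_le.1 (not_le.1 hh).le)
      have : |x| ^ (-(2 * a)) ≤ 1 :=
        Real.rpow_le_one_of_one_le_of_nonpos h1x (by linarith)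
      nlinarith

lemma ae_ne_zero : ∀ᵐ x : ℝ, x ≠ 0 := by
  simp [ae_iff]

lemma mix_f (f : ℝ → ℝ) (C a b : ℝ) (hC : 0 < C) (ha : 0 < a) (ha1 : a < 1 / 2) (hb : 1 / 2 < b)
    (hf : ∀ x : ℝ, x ≠ 0 → f x = C * |x| ^ (-(2 * a)) * (1 + x ^ 2) ^ (-b)) :
    IsMix (Mx (C / (Real.Gamma a * Real.Gamma b)) a b) f := by
  have hGa := Real.Gamma_pos_of_pos ha
  have hGb := Real.Gamma_pos_of_pos (by linarith : 0 < b)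
  have hm : Measurable (fun p : ℝ × ℝ => p.1 + p.2) := by fun_prop
  have hme : ∀ x : ℝ, Integrable (fun y => Real.exp (-y * x ^ 2))
      (((Pm b 1).prod (Pm a 0)).map (fun p => p.1 + p.2)) ↔
      Integrable (fun p : ℝ × ℝ => Real.exp (-(x ^ 2 * p.1)) * Real.exp (-(x ^ 2 * p.2)))
        ((Pm b 1).prod (Pm a 0)) := by
    intro x
    rw [integrable_map_measure (by apply Measurable.aestronglyMeasurable; fun_prop) hm.aemeasurable]
    apply integrable_congr (Eventually.of_forall fun p => ?_)
    simp only [Function.comp]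
    rw [← Real.exp_add]; congr 1; ring
  refine ⟨?_, ?_, ?_, ?_⟩
  · unfold Mx
    apply Measure.ae_smul_measure
    rw [ae_map_iff hm.aemeasurable measurableSet_Ioi]
    filter_upwards [Measure.quasiMeasurePreserving_fst.ae (Pm_pos b 1),
      Measure.quasiMeasurePreserving_snd.ae (Pm_pos a 0)] with p h1 h2
    exact add_pos h1 h2
  · filter_upwards [ae_ne_zero] with x hx
    have hx2 : 0 < x ^ 2 := by positivity
    unfold Mx
    refine Integrable.smul_measure ?_ ENNReal.ofReal_ne_top
    rw [hme]
    exact (Pm_exp_int b 1 (x ^ 2) (by linarith) (by positivity)).mul_prod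
      (Pm_exp_int a 0 (x ^ 2) ha (by linarith))
  · filter_upwards [ae_ne_zero] with x hx
    have hx2 : 0 < x ^ 2 := by positivity
    unfold Mx
    rw [hf x hx, integral_smul_measure, integral_map hm.aemeasurable
      (by apply Measurable.aestronglyMeasurable; fun_prop)]
    have : ∀ p : ℝ × ℝ, Real.exp (-(p.1 + p.2) * x ^ 2) =
      Real.exp (-(x ^ 2 * p.1)) * Real.exp (-(x ^ 2 * p.2)) := by
      intro p; rw [← Real.exp_add]; congr 1; ring
    simp_rw [this]
    rw [integral_prod_mul (fun u => Real.exp (-(x ^ 2 * u))) (fun u => Real.exp (-(x ^ 2 * u))),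
      Pm_exp b 1 (x ^ 2) (by linarith) (by positivity), Pm_exp a 0 (x ^ 2) ha (by linarith),
      ENNReal.toReal_ofReal (by positivity), smul_eq_mul, zero_add]
    have : |x| ^ (-(2 * a)) = (x ^ 2) ^ (-a) := by
      rw [← sq_abs, ← Real.rpow_natCast, ← Real.rpow_mul (abs_nonneg x)]
      congr 1; push_cast; ring
    rw [this]
    field_simp
  · refine (f_integrable C a b ha1 ha hb).congr ?_
    filter_upwards [ae_ne_zero] with x hx
    rw [hf x hx]

/-- Inner scaled integral. -/
def Kf (a s : ℝ) : ℝ := ∫ w, gphi (s + w) 1 ∂(Pm a 0)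

/-- Dominating function. -/
def Dom (w : ℝ) : ℝ := √π * (if w ≤ 1 then 1 else w ^ (-(1 / 2) : ℝ))

lemma gphi_one_le (y w : ℝ) (hw : 0 < w) (hwy : w ≤ y) : gphi y 1 ≤ Dom w := by
  have hy : 0 < y := lt_of_lt_of_le hw hwy
  have hsq : 0 < √y := Real.sqrt_pos.2 hy
  have hs2 : √y ^ 2 = y := Real.sq_sqrt hy.le
  unfold Dom
  split_ifs with h
  · unfold gphi
    rw [Real.sqrt_div Real.pi_pos.le, div_mul_eq_mul_div, mul_div_assoc]
    apply mul_le_mul_of_nonneg_left _ (Real.sqrt_nonneg _)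
    rw [div_le_one hsq]
    have h1 : Real.exp (-1 ^ 2 / (4 * y)) = (Real.exp (1 / (4 * y)))⁻¹ := by
      rw [← Real.exp_neg]; congr 1; ring
    rw [h1]
    apply inv_le_of_inv_le₀ hsq
    have h2 := Real.add_one_le_exp (1 / (4 * y))
    refine le_trans ?_ h2
    rw [inv_le_iff_one_le_mul₀ hsq]
    have e0 : 1 / (4 * y) = 1 / (4 * √y ^ 2) := by rw [hs2]
    rw [e0]
    have : (1 / (4 * √y ^ 2) + 1) * √y = (1 + 4 * √y ^ 2) / (4 * √y) := by
      field_simp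
    rw [this, le_div_iff₀ (by positivity)]
    nlinarith [sq_nonneg (2 * √y - 1)]
  · refine (gphi_le y 1 hy).trans ?_
    rw [Real.sqrt_div Real.pi_pos.le, div_eq_mul_inv]
    apply mul_le_mul_of_nonneg_left _ (Real.sqrt_nonneg _)
    rw [Real.rpow_neg hw.le, ← Real.sqrt_eq_rpow]
    exact inv_anti₀ (Real.sqrt_pos.2 hw) (Real.sqrt_le_sqrt hwy)

lemma Dom_int (a : ℝ) (ha : 0 < a) (ha1 : a < 1 / 2) : Integrable Dom (Pm a 0) := by
  rw [Pm_integrable]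
  have hU : Ioi (0 : ℝ) = Ioc 0 1 ∪ Ioi 1 := by rw [Ioc_union_Ioi_eq_Ioi zero_le_one]
  rw [hU]
  refine IntegrableOn.union ?_ ?_
  · have := ((intervalIntegral.intervalIntegrable_rpow' (a := 0) (b := 1)
        (r := a - 1) (by linarith)).1).mul_const (√π)
    refine IntegrableOn.congr_fun this ?_ measurableSet_Ioc
    intro x hx
    simp [Dom, hx.2]
  · have := (integrableOn_Ioi_rpow_of_lt (a := a - 3 / 2) (by linarith) one_pos).mul_const (√π)
    refine IntegrableOn.congr_fun this ?_ measurableSet_Ioi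
    intro x hx
    have hx : 1 < x := hx
    simp only [Dom, not_le.2 hx, if_false, zero_mul, neg_zero, Real.exp_zero, mul_one]
    have : x ^ (a - 3 / 2) = x ^ (a - 1) * x ^ (-(1 / 2) : ℝ) := by
      rw [← Real.rpow_add (by linarith)]; congr 1; ring
    rw [this]; ring

lemma gphi_meas_left (s t : ℝ) : Measurable (fun w => gphi (s + w) t) := by
  unfold gphi; fun_prop

lemma Kf_bound (a s : ℝ) (ha : 0 < a) (ha1 : a < 1 / 2) (hs : 0 ≤ s) :
    ‖Kf a s‖ ≤ ∫ w, Dom w ∂(Pm a 0) := by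
  unfold Kf
  apply norm_integral_le_of_norm_le (Dom_int a ha ha1)
  filter_upwards [Pm_pos a 0] with w hw
  rw [Real.norm_of_nonneg (gphi_nonneg _ _)]
  exact gphi_one_le _ _ hw (by linarith)

lemma gphi_cont (y : ℝ) (hy : 0 < y) : ContinuousAt (fun y => gphi y 1) y := by
  unfold gphi
  have h1 : y ≠ 0 := hy.ne'
  have h2 : 4 * y ≠ 0 := by positivity
  fun_prop (disch := assumption)

lemma Kf_tendsto (a : ℝ) (ha : 0 < a) (ha1 : a < 1 / 2) {ι : Type*} {l : Filter ι}
    [l.IsCountablyGenerated] (s : ι → ℝ) (hs : ∀ᶠ i in l, 0 ≤ s i) (h0 : Tendsto s l (𝓝 0)) :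
    Tendsto (fun i => Kf a (s i)) l (𝓝 (Kf a 0)) := by
  unfold Kf
  refine tendsto_integral_filter_of_dominated_convergence Dom
    (Eventually.of_forall fun i => (gphi_meas_left _ _).aestronglyMeasurable) ?_
    (Dom_int a ha ha1) ?_
  · filter_upwards [hs] with i hi
    filter_upwards [Pm_pos a 0] with w hw
    rw [Real.norm_of_nonneg (gphi_nonneg _ _)]
    exact gphi_one_le _ _ hw (by linarith)
  · filter_upwards [Pm_pos a 0] with w hw
    have : Tendsto (fun i => s i + w) l (𝓝 (0 + w)) := h0.add_const w
    exact (gphi_cont (0 + w) (by linarith)).tendsto.comp this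

lemma gphi_scale (t y : ℝ) (ht : 0 < t) (hy : 0 < y) : gphi (t ^ 2 * y) t = t⁻¹ * gphi y 1 := by
  unfold gphi
  have h1 : √(π / (t ^ 2 * y)) = t⁻¹ * √(π / y) := by
    have : π / (t ^ 2 * y) = (t⁻¹) ^ 2 * (π / y) := by field_simp
    rw [this, Real.sqrt_mul (by positivity), Real.sqrt_sq (by positivity)]
  have h2 : -t ^ 2 / (4 * (t ^ 2 * y)) = -1 ^ 2 / (4 * y) := by field_simp
  rw [h1, h2, mul_assoc]

lemma inner_scale (a u t : ℝ) (hu : 0 < u) (ht : 0 < t) :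
    ∫ v, gphi (u + v) t ∂(Pm a 0) = t ^ (2 * a - 1) * Kf a (u / t ^ 2) := by
  unfold Kf
  rw [Pm_integral, Pm_integral]
  have ht2 : 0 < t ^ 2 := by positivity
  have := integral_comp_mul_left_Ioi
    (fun v => v ^ (a - 1) * Real.exp (-(0 * v)) * gphi (u + v) t) 0 ht2
  rw [mul_zero, smul_eq_mul] at this
  have e : (∫ v in Ioi (0 : ℝ), v ^ (a - 1) * Real.exp (-(0 * v)) * gphi (u + v) t) =
    t ^ 2 * ∫ v in Ioi (0 : ℝ), (t ^ 2 * v) ^ (a - 1) * Real.exp (-(0 * (t ^ 2 * v))) *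
      gphi (u + t ^ 2 * v) t := by
    rw [this]; field_simp
  rw [e, ← integral_const_mul, ← integral_const_mul]
  apply setIntegral_congr_fun measurableSet_Ioi
  intro v hv
  have hv : 0 < v := hv
  simp only [zero_mul, neg_zero, Real.exp_zero, mul_one]
  have e1 : u + t ^ 2 * v = t ^ 2 * (u / t ^ 2 + v) := by field_simp
  rw [e1, gphi_scale t _ ht (by positivity), Real.mul_rpow ht2.le hv.le]
  have e2 : t ^ 2 * (t ^ 2) ^ (a - 1) * t⁻¹ = t ^ (2 * a - 1) := by
    rw [← Real.rpow_natCast, ← Real.rpow_mul ht.le, ← Real.rpow_neg_one, ← Real.rpow_add ht,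
      ← Real.rpow_add ht]
    congr 1; push_cast; ring
  rw [← e2]; ring

lemma gh_Mx (f : ℝ → ℝ) (c a b t : ℝ) (hc : 0 < c) (h : IsMix (Mx c a b) f) (ht : 0 < t) :
    gh (Mx c a b) t = t ^ (2 * a - 1) * (c * ∫ u, Kf a (u / t ^ 2) ∂(Pm b 1)) := by
  have hm : Measurable (fun p : ℝ × ℝ => p.1 + p.2) := by fun_prop
  have hg : Measurable (fun y => gphi y t) := by unfold gphi; fun_prop
  have hi := h.phi_int t
  have hi2 : Integrable (fun p : ℝ × ℝ => gphi (p.1 + p.2) t) ((Pm b 1).prod (Pm a 0)) := by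
    unfold Mx at hi
    rw [integrable_smul_measure (by simpa using hc) ENNReal.ofReal_ne_top,
      integrable_map_measure hg.aestronglyMeasurable hm.aemeasurable] at hi
    exact hi
  unfold gh
  rw [Mx, integral_smul_measure, integral_map hm.aemeasurable hg.aestronglyMeasurable,
    integral_prod _ hi2, ENNReal.toReal_ofReal hc.le, smul_eq_mul, mul_left_comm,
    ← integral_const_mul (t ^ (2 * a - 1))]
  congr 1
  apply integral_congr_ae
  filter_upwards [Pm_pos b 1] with u hu
  exact inner_scale a u t hu ht

lemma Kf_zero (a : ℝ) (ha : 0 < a) (ha1 : a < 1 / 2) :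
    Kf a 0 = √π * ((4 : ℝ) ^ (1 / 2 - a) * Real.Gamma (1 / 2 - a)) := by
  have h1 := @Real.integral_rpow_mul_exp_neg_mul_Ioi (1 / 2 - a) (1 / 4) (by linarith) (by norm_num)
  have h2 := integral_comp_rpow_Ioi (fun y => y ^ (1 / 2 - a - 1) * Real.exp (-(1 / 4 * y)))
    (p := -1) (by norm_num)
  rw [h1] at h2
  have e4 : (1 / (1 / 4) : ℝ) = 4 := by norm_num
  rw [e4] at h2
  rw [← h2, ← integral_const_mul]
  unfold Kf
  rw [Pm_integral]
  apply setIntegral_congr_fun measurableSet_Ioi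
  intro v hv
  have hv : 0 < v := hv
  simp only [zero_mul, neg_zero, Real.exp_zero, mul_one, zero_add, smul_eq_mul, abs_neg, abs_one,
    one_mul, gphi]
  rw [Real.sqrt_div Real.pi_pos.le, ← Real.rpow_mul hv.le, Real.sqrt_eq_rpow v, div_eq_mul_inv,
    ← Real.rpow_neg hv.le]
  have e1 : v ^ (a - 1) * v ^ (-(1 / 2) : ℝ) = v ^ (-1 - 1 : ℝ) * v ^ (-1 * (1 / 2 - a - 1)) := by
    rw [← Real.rpow_add hv, ← Real.rpow_add hv]; congr 1; ring
  have e2 : -1 ^ 2 / (4 * v) = -(1 / 4 * v ^ (-1 : ℝ)) := by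
    rw [Real.rpow_neg_one]; field_simp
  rw [← e2]
  calc _ = √π * (v ^ (a - 1) * v ^ (-(1 / 2) : ℝ)) * Real.exp (-1 ^ 2 / (4 * v)) := by ring
    _ = _ := by rw [e1]; ring

/-- The constant in the asymptotics of the Fourier transform. -/
def kap (C a : ℝ) : ℝ := C * π / (Real.cos (π * a) * Real.Gamma (2 * a))

lemma cos_pos_a (a : ℝ) (ha : 0 < a) (ha1 : a < 1 / 2) : 0 < Real.cos (π * a) := by
  apply Real.cos_pos_of_mem_Ioo
  constructor <;> nlinarith [Real.pi_pos]

lemma kap_eq (C a b : ℝ) (ha : 0 < a) (ha1 : a < 1 / 2) (hb : 1 / 2 < b) :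
    C / (Real.Gamma a * Real.Gamma b) * (Kf a 0 * Real.Gamma b) = kap C a := by
  have hGa := Real.Gamma_pos_of_pos ha
  have hGb := Real.Gamma_pos_of_pos (by linarith : 0 < b)
  have hGc := Real.Gamma_pos_of_pos (by linarith : 0 < a + 1 / 2)
  have hGd := Real.Gamma_pos_of_pos (by linarith : 0 < 2 * a)
  have hcos := cos_pos_a a ha ha1
  have hd := Real.Gamma_mul_Gamma_add_half a
  have hr := Real.Gamma_mul_Gamma_one_sub (a + 1 / 2)
  have e1 : 1 - (a + 1 / 2) = 1 / 2 - a := by ring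
  have e2 : Real.sin (π * (a + 1 / 2)) = Real.cos (π * a) := by
    rw [← Real.sin_add_pi_div_two]; congr 1; ring
  rw [e1, e2] at hr
  have e3 : (4 : ℝ) ^ (1 / 2 - a) = 2 ^ (1 - 2 * a) := by
    have : (4 : ℝ) = 2 ^ (2 : ℝ) := by norm_num
    rw [this, ← Real.rpow_mul (by norm_num)]; congr 1; ring
  rw [Kf_zero a ha ha1, e3, kap]
  rw [div_mul_eq_mul_div, div_eq_div_iff (by positivity) (by positivity)]
  have hr' : Real.Gamma (1 / 2 - a) * (Real.Gamma (a + 1 / 2) * Real.cos (π * a)) = π := by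
    rw [eq_div_iff hcos.ne'] at hr
    linarith
  have hA : Real.Gamma (a + 1 / 2) ≠ 0 := hGc.ne'
  apply mul_right_cancel₀ hA
  calc _ = C * Real.Gamma b * (Real.Gamma (2 * a) * 2 ^ (1 - 2 * a) * √π) *
        (Real.Gamma (1 / 2 - a) * (Real.Gamma (a + 1 / 2) * Real.cos (π * a))) := by ring
    _ = _ := by rw [hr', ← hd]; ring

lemma Pm_one (b : ℝ) (hb : 0 < b) : IsFiniteMeasure (Pm b 1) ∧ ∫ _u, (1 : ℝ) ∂(Pm b 1) = Real.Gamma b := by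
  have h1 := Pm_exp_int b 1 0 hb (by norm_num)
  have h2 := Pm_exp b 1 0 hb (by norm_num)
  simp only [zero_mul, neg_zero, Real.exp_zero, add_zero, Real.one_rpow, mul_one] at h1 h2
  refine ⟨?_, h2⟩
  rcases (integrable_const_iff).1 h1 with h | h
  · norm_num at h
  · exact h

/-- Asymptotics and global bound for the Fourier transform. -/
lemma gh_asymp (f : ℝ → ℝ) (C a b : ℝ) (hC : 0 < C) (ha : 0 < a) (ha1 : a < 1 / 2) (hb : 1 / 2 < b)
    (h : IsMix (Mx (C / (Real.Gamma a * Real.Gamma b)) a b) f) :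
    ∃ k : ℝ → ℝ, ∃ B : ℝ, (∀ t, 0 < t → gh (Mx (C / (Real.Gamma a * Real.Gamma b)) a b) t =
      t ^ (2 * a - 1) * k t) ∧ (∀ t, 0 < t → |k t| ≤ B) ∧ Tendsto k atTop (𝓝 (kap C a)) := by
  have hGa := Real.Gamma_pos_of_pos ha
  have hGb := Real.Gamma_pos_of_pos (by linarith : 0 < b)
  have hc : 0 < C / (Real.Gamma a * Real.Gamma b) := by positivity
  set c := C / (Real.Gamma a * Real.Gamma b) with hcdef
  obtain ⟨hfin, hone⟩ := Pm_one b (by linarith)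
  set D := ∫ w, Dom w ∂(Pm a 0) with hD
  have hbd : ∀ t : ℝ, 0 < t → ∀ᵐ u ∂(Pm b 1), ‖Kf a (u / t ^ 2)‖ ≤ D := by
    intro t ht
    filter_upwards [Pm_pos b 1] with u hu
    exact Kf_bound a _ ha ha1 (by positivity)
  refine ⟨fun t => c * ∫ u, Kf a (u / t ^ 2) ∂(Pm b 1), c * ∫ _u, D ∂(Pm b 1),
    fun t ht => gh_Mx f c a b t hc h ht, ?_, ?_⟩
  · intro t ht
    rw [abs_mul, abs_of_pos hc]
    apply mul_le_mul_of_nonneg_left _ hc.le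
    exact norm_integral_le_of_norm_le (integrable_const D) (hbd t ht)
  · have : kap C a = c * ∫ _u, Kf a 0 ∂(Pm b 1) := by
      have : ∫ _u, Kf a 0 ∂(Pm b 1) = Kf a 0 * Real.Gamma b := by
        rw [← hone, ← integral_const_mul]; simp
      rw [this, hcdef, kap_eq C a b ha ha1 hb]
    rw [this]
    apply Tendsto.const_mul
    refine tendsto_integral_filter_of_dominated_convergence (fun _ => D) ?_ ?_
      (integrable_const D) ?_
    · refine Eventually.of_forall fun t => ?_
      unfold Kf
      apply StronglyMeasurable.aestronglyMeasurable
      apply StronglyMeasurable.integral_prod_right (f := fun u w : ℝ => gphi (u / t ^ 2 + w) 1)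
      apply Measurable.stronglyMeasurable
      unfold gphi Function.uncurry
      fun_prop
    · filter_upwards [eventually_gt_atTop 0] with t ht using hbd t ht
    · filter_upwards [Pm_pos b 1] with u hu
      apply Kf_tendsto a ha ha1
      · exact Eventually.of_forall fun t => by positivity
      · exact Tendsto.div_atTop tendsto_const_nhds (tendsto_pow_atTop (by norm_num))

section tail
variable (g : ℝ → ℝ) (q B K : ℝ)

lemma g_intOn (hg : Continuous g) (hq : 0 < q) (hB : ∀ t, 0 < t → |t ^ (q + 1) * g t| ≤ B) :
    IntegrableOn g (Ioi 0) := by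
  have hU : Ioi (0 : ℝ) = Ioc 0 1 ∪ Ioi 1 := by rw [Ioc_union_Ioi_eq_Ioi zero_le_one]
  rw [hU]
  refine IntegrableOn.union ?_ ?_
  · exact (hg.integrableOn_Icc).mono_set Ioc_subset_Icc_self
  · have := (integrableOn_Ioi_rpow_of_lt (a := -q - 1) (by linarith) one_pos).const_mul B
    refine Integrable.mono' this hg.aestronglyMeasurable ?_
    refine (ae_restrict_iff' measurableSet_Ioi).2 (Eventually.of_forall fun t ht => ?_)
    have ht : 1 < t := ht
    have ht0 : 0 < t := by linarith
    have h1 := hB t ht0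
    rw [abs_mul, abs_of_pos (Real.rpow_pos_of_pos ht0 _)] at h1
    rw [Real.norm_eq_abs, show -q - 1 = -(q + 1) by ring, Real.rpow_neg ht0.le,
      ← div_eq_mul_inv, le_div_iff₀ (Real.rpow_pos_of_pos ht0 _)]
    linarith

lemma tail_eq (t : ℝ) (ht : 0 < t) :
    t ^ q * ∫ x in Ioi t, g x =
      ∫ s in Ioi (1 : ℝ), s ^ (-q - 1) * ((t * s) ^ (q + 1) * g (t * s)) := by
  have := integral_comp_mul_left_Ioi g 1 ht
  rw [mul_one, smul_eq_mul] at this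
  have e : ∫ x in Ioi t, g x = t * ∫ x in Ioi (1 : ℝ), g (t * x) := by
    rw [this]; field_simp
  rw [e, ← mul_assoc, ← integral_const_mul]
  apply setIntegral_congr_fun measurableSet_Ioi
  intro s hs
  have hs : 1 < s := hs
  have hs0 : 0 < s := by linarith
  simp only
  rw [Real.mul_rpow ht.le hs0.le, Real.rpow_add_one ht.ne', show -q - 1 = -(q + 1) by ring,
    Real.rpow_neg hs0.le]
  have := Real.rpow_pos_of_pos hs0 (q + 1)
  field_simp

lemma tail_bound (hq : 0 < q) (hB : ∀ t, 0 < t → |t ^ (q + 1) * g t| ≤ B)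
    (t : ℝ) (ht : 0 < t) : |t ^ q * ∫ x in Ioi t, g x| ≤ ∫ s in Ioi (1 : ℝ), s ^ (-q - 1) * B := by
  rw [tail_eq g q t ht]
  rw [← Real.norm_eq_abs]
  refine norm_integral_le_of_norm_le
    (μ := (volume : Measure ℝ).restrict (Ioi 1))
    (f := fun s => s ^ (-q - 1) * ((t * s) ^ (q + 1) * g (t * s)))
    (g := fun s => s ^ (-q - 1) * B)
    ((integrableOn_Ioi_rpow_of_lt (a := -q - 1) (by linarith) one_pos).mul_const B) ?_
  refine (ae_restrict_iff' measurableSet_Ioi).2 (Eventually.of_forall fun s hs => ?_)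
  have hs : 1 < s := hs
  have hs0 : 0 < s := by linarith
  have hp := Real.rpow_pos_of_pos hs0 (-q - 1)
  rw [norm_mul, Real.norm_of_nonneg hp.le]
  exact mul_le_mul_of_nonneg_left (hB (t * s) (by positivity)) hp.le

lemma tail_tendsto (hg : Continuous g) (hq : 0 < q) (hB : ∀ t, 0 < t → |t ^ (q + 1) * g t| ≤ B)
    (hK : Tendsto (fun t => t ^ (q + 1) * g t) atTop (𝓝 K)) :
    Tendsto (fun t => t ^ q * ∫ x in Ioi t, g x) atTop (𝓝 (K / q)) := by
  have h1 : Tendsto (fun t : ℝ => ∫ s in Ioi (1 : ℝ), s ^ (-q - 1) * ((t * s) ^ (q + 1) * g (t * s)))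
      atTop (𝓝 (∫ s in Ioi (1 : ℝ), s ^ (-q - 1) * K)) := by
    refine tendsto_integral_filter_of_dominated_convergence (fun s => s ^ (-q - 1) * B) ?_ ?_
      ((integrableOn_Ioi_rpow_of_lt (a := -q - 1) (by linarith) one_pos).mul_const B) ?_
    · refine Eventually.of_forall fun t => ?_
      apply Measurable.aestronglyMeasurable
      have := hg.measurable
      fun_prop
    · filter_upwards [eventually_gt_atTop 0] with t ht
      refine (ae_restrict_iff' measurableSet_Ioi).2 (Eventually.of_forall fun s hs => ?_)
      have hs : 1 < s := hs
      have hs0 : 0 < s := by linarith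
      have hp := Real.rpow_pos_of_pos hs0 (-q - 1)
      rw [norm_mul, Real.norm_of_nonneg hp.le]
      exact mul_le_mul_of_nonneg_left (hB (t * s) (by positivity)) hp.le
    · refine (ae_restrict_iff' measurableSet_Ioi).2 (Eventually.of_forall fun s hs => ?_)
      have hs : 1 < s := hs
      apply Tendsto.const_mul
      exact hK.comp (tendsto_id.atTop_mul_const (by linarith : 0 < s))
  have h2 : ∫ s in Ioi (1 : ℝ), s ^ (-q - 1) * K = K / q := by
    rw [integral_mul_const, integral_Ioi_rpow_of_lt (by linarith) one_pos]
    simp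
    field_simp
  rw [h2] at h1
  refine h1.congr' ?_
  filter_upwards [eventually_gt_atTop 0] with t ht
  rw [tail_eq g q t ht]

lemma int_tendsto (R : ℝ → ℝ) (hR : Continuous R) (hq : 0 < q) (hq1 : q < 1)
    (hB : ∀ t, 0 < t → |t ^ q * R t| ≤ B)
    (hK : Tendsto (fun t => t ^ q * R t) atTop (𝓝 K)) :
    Tendsto (fun T => T ^ q * (T⁻¹ * ∫ t in (0 : ℝ)..T, R t)) atTop (𝓝 (K / (1 - q))) := by
  have hri : IntervalIntegrable (fun s : ℝ => s ^ (-q)) volume 0 1 :=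
    intervalIntegral.intervalIntegrable_rpow' (by linarith)
  have h1 : Tendsto (fun T : ℝ => ∫ s in (0 : ℝ)..1, s ^ (-q) * ((T * s) ^ q * R (T * s)))
      atTop (𝓝 (∫ s in (0 : ℝ)..1, s ^ (-q) * K)) := by
    refine intervalIntegral.tendsto_integral_filter_of_dominated_convergence
      (fun s => s ^ (-q) * B) ?_ ?_ (hri.mul_const B) ?_
    · refine Eventually.of_forall fun t => ?_
      apply Measurable.aestronglyMeasurable
      have := hR.measurable
      fun_prop
    · filter_upwards [eventually_gt_atTop 0] with t ht
      refine Eventually.of_forall fun s hs => ?_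
      rw [uIoc_of_le zero_le_one] at hs
      have hs0 : 0 < s := hs.1
      have hp := Real.rpow_pos_of_pos hs0 (-q)
      rw [norm_mul, Real.norm_of_nonneg hp.le]
      exact mul_le_mul_of_nonneg_left (hB (t * s) (by positivity)) hp.le
    · refine Eventually.of_forall fun s hs => ?_
      rw [uIoc_of_le zero_le_one] at hs
      apply Tendsto.const_mul
      exact hK.comp (tendsto_id.atTop_mul_const hs.1)
  have h2 : ∫ s in (0 : ℝ)..1, s ^ (-q) * K = K / (1 - q) := by
    rw [intervalIntegral.integral_mul_const, integral_rpow (Or.inl (by linarith))]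
    have : -q + 1 ≠ 0 := by linarith
    rw [Real.one_rpow, Real.zero_rpow this, show -q + 1 = 1 - q by ring]
    ring
  rw [h2] at h1
  refine h1.congr' ?_
  filter_upwards [eventually_gt_atTop 0] with T hT
  have e := intervalIntegral.integral_comp_mul_left (a := 0) (b := 1) R hT.ne'
  rw [mul_zero, mul_one, smul_eq_mul] at e
  rw [← e, ← intervalIntegral.integral_const_mul]
  rw [intervalIntegral.integral_of_le zero_le_one, intervalIntegral.integral_of_le zero_le_one]
  apply setIntegral_congr_fun measurableSet_Ioc
  intro s hs
  have hs0 : 0 < s := hs.1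
  simp only
  rw [Real.mul_rpow hT.le hs0.le, Real.rpow_neg hs0.le]
  have := Real.rpow_pos_of_pos hs0 q
  field_simp

lemma double_int (hg : Continuous g) (hev : ∀ t, g (-t) = g t) (T : ℝ) :
    ∫ t in (0 : ℝ)..T, ∫ s in (0 : ℝ)..T, g (t - s) =
      2 * ∫ t in (0 : ℝ)..T, ∫ x in (0 : ℝ)..t, g x := by
  have hi : ∀ a b, IntervalIntegrable g volume a b := fun a b => hg.intervalIntegrable a b
  have hc : Continuous (fun t => ∫ x in (0 : ℝ)..t, g x) :=
    intervalIntegral.continuous_primitive hi 0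
  have h1 : ∀ t, ∫ s in (0 : ℝ)..T, g (t - s) =
      (∫ x in (0 : ℝ)..t, g x) + ∫ x in (0 : ℝ)..(T - t), g x := by
    intro t
    rw [intervalIntegral.integral_comp_sub_left (fun x => g x), sub_zero]
    have h2 : ∫ x in (0 : ℝ)..(T - t), g x = ∫ x in (t - T)..0, g x := by
      have := intervalIntegral.integral_comp_neg (a := 0) (b := T - t) (fun x => g x)
      simp only [hev, neg_zero, neg_sub] at this
      exact this
    rw [h2, add_comm, intervalIntegral.integral_add_adjacent_intervals (hi _ _) (hi _ _)]
  simp_rw [h1]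
  have hc2 : Continuous (fun t => ∫ x in (0 : ℝ)..(T - t), g x) :=
    hc.comp (continuous_const.sub continuous_id)
  rw [intervalIntegral.integral_add (hc.intervalIntegrable _ _) (hc2.intervalIntegrable _ _)]
  have h3 := intervalIntegral.integral_comp_sub_left (a := 0) (b := T)
    (fun t => ∫ x in (0 : ℝ)..t, g x) T
  rw [sub_self, sub_zero] at h3
  rw [h3]; ring

lemma main_asymp (hg : Continuous g) (hev : ∀ t, g (-t) = g t) (hq : 0 < q) (hq1 : q < 1)
    (hB : ∀ t, 0 < t → |t ^ (q + 1) * g t| ≤ B)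
    (hK : Tendsto (fun t => t ^ (q + 1) * g t) atTop (𝓝 K)) :
    Tendsto (fun T => T ^ q * (T⁻¹ * (∫ t in (0 : ℝ)..T, ∫ s in (0 : ℝ)..T, g (t - s))
      - 2 * ∫ x in Ioi (0 : ℝ), g x)) atTop (𝓝 (-(2 * (K / q / (1 - q))))) := by
  have hint := g_intOn g q B hg hq hB
  have hi : ∀ a b, IntervalIntegrable g volume a b := fun a b => hg.intervalIntegrable a b
  have hc : Continuous (fun t => ∫ x in (0 : ℝ)..t, g x) :=
    intervalIntegral.continuous_primitive hi 0
  set I := ∫ x in Ioi (0 : ℝ), g x with hI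
  -- continuous extension of the tail
  set R : ℝ → ℝ := fun t => I - ∫ x in (0 : ℝ)..t, g x with hRdef
  have hR : Continuous R := continuous_const.sub hc
  have hRt : ∀ t, 0 < t → R t = ∫ x in Ioi t, g x := by
    intro t ht
    have := intervalIntegral.integral_Ioi_sub_Ioi hint ht.le
    simp only [hRdef]
    linarith
  have hRB : ∀ t, 0 < t → |t ^ q * R t| ≤ ∫ s in Ioi (1 : ℝ), s ^ (-q - 1) * B := by
    intro t ht
    rw [hRt t ht]; exact tail_bound g q B hq hB t ht
  have hRK : Tendsto (fun t => t ^ q * R t) atTop (𝓝 (K / q)) := by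
    refine (tail_tendsto g q B K hg hq hB hK).congr' ?_
    filter_upwards [eventually_gt_atTop 0] with t ht
    rw [hRt t ht]
  have h := ((int_tendsto q _ (K / q) R hR hq hq1 hRB hRK).const_mul 2).neg
  refine h.congr' ?_
  filter_upwards [eventually_gt_atTop 0] with T hT
  rw [double_int g hg hev T]
  have : ∫ t in (0 : ℝ)..T, R t = T * I - ∫ t in (0 : ℝ)..T, ∫ x in (0 : ℝ)..t, g x := by
    simp only [hRdef]
    rw [intervalIntegral.integral_sub (by simp) (hc.intervalIntegrable _ _)]
    simp
  rw [this]
  field_simp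
  ring

end tail

theorem stmt19 (f : Fin 2 → ℝ → ℝ) (Cc α β : Fin 2 → ℝ)
    (hC : ∀ i, 0 < Cc i) (hα : ∀ i, 0 < α i ∧ α i < 1 / 2) (hβ : ∀ i, 1 / 2 < β i)
    (hf : ∀ i, ∀ x : ℝ, x ≠ 0 →
      f i x = Cc i * |x| ^ (-(2 * α i)) * (1 + x ^ 2) ^ (-(β i)))
    (hαsum : α 0 + α 1 < 1 / 2) :
    (fun T : ℝ =>
      S1W (f 0) (f 1) T - ((2 * π * ∫ x : ℝ, f 0 x * f 1 x : ℝ) : ℂ)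
        + ((Cα (Cc 0) (Cc 1) (α 0) (α 1) *
            T ^ (-(1 - 2 * (α 0 + α 1))) : ℝ) : ℂ))
      =o[atTop] fun T : ℝ => T ^ (-(1 - 2 * (α 0 + α 1))) := by
  have hm : ∀ i, IsMix (Mx (Cc i / (Real.Gamma (α i) * Real.Gamma (β i))) (α i) (β i)) (f i) :=
    fun i => mix_f (f i) (Cc i) (α i) (β i) (hC i) (hα i).1 (hα i).2 (hβ i) (hf i)
  have has := fun i => gh_asymp (f i) (Cc i) (α i) (β i) (hC i) (hα i).1 (hα i).2 (hβ i) (hm i)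
  set M : Fin 2 → Measure ℝ :=
    fun i => Mx (Cc i / (Real.Gamma (α i) * Real.Gamma (β i))) (α i) (β i) with hM
  haveI : ∀ i, SFinite (M i) := fun i => by simp only [hM]; infer_instance
  obtain ⟨k0, B0, hk0, hB0, hT0⟩ := has 0
  obtain ⟨k1, B1, hk1, hB1, hT1⟩ := has 1
  obtain ⟨ha0, ha0'⟩ := hα 0
  obtain ⟨ha1, ha1'⟩ := hα 1
  set q := 1 - 2 * (α 0 + α 1) with hq
  set g : ℝ → ℝ := fun t => gh (M 0) t * gh (M 1) t with hg
  have hgc : Continuous g := (hm 0).cont.mul (hm 1).cont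
  have hev : ∀ t, g (-t) = g t := fun t => by simp only [hg, gh_even]
  have hgk : ∀ t, 0 < t → t ^ (q + 1) * g t = k0 t * k1 t := by
    intro t ht
    have e0 := hk0 t ht
    have e1 := hk1 t ht
    have e2 : t ^ (q + 1) * (t ^ (2 * α 0 - 1) * t ^ (2 * α 1 - 1)) = 1 := by
      rw [← Real.rpow_add ht, ← Real.rpow_add ht]
      have : q + 1 + (2 * α 0 - 1 + (2 * α 1 - 1)) = 0 := by rw [hq]; ring
      rw [this, Real.rpow_zero]
    simp only [hg, hM]
    rw [e0, e1]
    calc _ = (t ^ (q + 1) * (t ^ (2 * α 0 - 1) * t ^ (2 * α 1 - 1))) * (k0 t * k1 t) := by ring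
      _ = _ := by rw [e2, one_mul]
  have hB : ∀ t, 0 < t → |t ^ (q + 1) * g t| ≤ B0 * B1 := by
    intro t ht
    rw [hgk t ht, abs_mul]
    exact mul_le_mul (hB0 t ht) (hB1 t ht) (abs_nonneg _) ((abs_nonneg _).trans (hB0 t ht))
  have hK : Tendsto (fun t => t ^ (q + 1) * g t) atTop
      (𝓝 (kap (Cc 0) (α 0) * kap (Cc 1) (α 1))) := by
    refine (hT0.mul hT1).congr' ?_
    filter_upwards [eventually_gt_atTop 0] with t ht
    rw [hgk t ht]
  have hq0 : 0 < q := by rw [hq]; linarith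
  have hq1 : q < 1 := by rw [hq]; linarith
  have hmain := main_asymp g q (B0 * B1) _ hgc hev hq0 hq1 hB hK
  have hI : 2 * ∫ x in Ioi (0 : ℝ), g x = 2 * π * ∫ x : ℝ, f 0 x * f 1 x := by
    rw [← parseval (hm 0) (hm 1), ← integral_comp_abs]
    congr 1
    ext x
    rcases abs_choice x with h | h <;> rw [h]
    exact hev x
  have hS : ∀ T, S1W (f 0) (f 1) T =
      ((T⁻¹ * (∫ t in (0 : ℝ)..T, ∫ s in (0 : ℝ)..T, g (t - s)) : ℝ) : ℂ) := by
    intro T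
    unfold S1W
    push_cast
    congr 1
    rw [← intervalIntegral.integral_ofReal]
    congr 1
    ext t
    rw [← intervalIntegral.integral_ofReal]
    congr 1
    ext s
    rw [(hm 0).hat, (hm 1).hat, ← neg_sub t s, gh_even]
    simp [hg, hM]
  have hCα : Cα (Cc 0) (Cc 1) (α 0) (α 1) =
      2 * (kap (Cc 0) (α 0) * kap (Cc 1) (α 1) / q / (1 - q)) := by
    have c0 := cos_pos_a _ ha0 ha0'
    have c1 := cos_pos_a _ ha1 ha1'
    have g0 := Real.Gamma_pos_of_pos (by linarith : 0 < 2 * α 0)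
    have g1 := Real.Gamma_pos_of_pos (by linarith : 0 < 2 * α 1)
    have e : 1 - q = 2 * (α 0 + α 1) := by rw [hq]; ring
    have e' : 0 < α 0 + α 1 := by linarith
    rw [e]
    unfold Cα kap
    rw [← hq]
    field_simp
  rw [← hI]
  simp_rw [hS, ← Complex.ofReal_sub, ← Complex.ofReal_add]
  rw [Complex.isLittleO_ofReal_left]
  rw [isLittleO_iff_tendsto']
  · have h2 := hmain.add_const (Cα (Cc 0) (Cc 1) (α 0) (α 1))
    rw [hCα, neg_add_cancel, ← hCα] at h2
    refine h2.congr' ?_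
    filter_upwards [eventually_gt_atTop 0] with T hT
    have hp := Real.rpow_pos_of_pos hT q
    rw [Real.rpow_neg hT.le]
    field_simp
  · filter_upwards [eventually_gt_atTop 0] with T hT h0
    exact absurd h0 (Real.rpow_pos_of_pos hT _).ne'
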